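/- The maps φ_m form a chain map from the Koszul complex of A to the bar resolution of A: for every m ≥ 1, φ_{m−1} ∘ d_m = δ_m ∘ φ_m, where φ_0 = id on A^e = A ⊗ A. -/

import Mathlib

set_option synthInstance.maxHeartbeats 1000000
set_option maxHeartbeats 1000000

noncomputable section

open scoped TensorProduct

section QSA
variable (k : Type) [Field k] (N : ℕ) (q : Fin N → Fin N → k)

/-- The commutation relations of the quantum symmetric algebra. -/
inductive QRel : FreeAlgebra k (Fin N) → FreeAlgebra k (Fin N) → Prop
  | rel (i j : Fin N) : QRel (FreeAlgebra.ι k i * FreeAlgebra.ι k j)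
      (q i j • (FreeAlgebra.ι k j * FreeAlgebra.ι k i))

/-- The quantum symmetric algebra `A = S_q(V)`. -/
abbrev QSA := RingQuot (QRel k N q)

/-- The generator `x_i` of `S_q(V)`. -/
def X (i : Fin N) : QSA k N q := RingQuot.mkAlgHom k (QRel k N q) (FreeAlgebra.ι k i)

/-- The product `x_{j_1} x_{j_2} ⋯ x_{j_m}` associated to a tuple `j : Fin m → Fin N`. -/
def xprod (m : ℕ) (j : Fin m → Fin N) : QSA k N q := (List.ofFn fun t => X k N q (j t)).prod

/-- The enveloping algebra `A^e = A ⊗_k A^{op}`. -/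
abbrev QSAe := QSA k N q ⊗[k] (QSA k N q)ᵐᵒᵖ

/-- The tower of tensor powers: `TP n` is `A^{⊗(n+1)}`, as a `k`-module. -/
def TP : ℕ → ModuleCat k
  | 0 => ModuleCat.of k (QSA k N q)
  | n + 1 => ModuleCat.of k (QSA k N q ⊗[k] TP n)

/-- An elementary tensor `v 0 ⊗ v 1 ⊗ ⋯ ⊗ v n` in `A^{⊗(n+1)}`. -/
def tp : (n : ℕ) → (Fin (n + 1) → QSA k N q) → TP k N q n
  | 0, v => v 0
  | n + 1, v => show QSA k N q ⊗[k] TP k N q n from (v 0) ⊗ₜ[k] tp n (fun t => v t.succ)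

/-- Left multiplication by an element of `A` on the first tensor factor of `A^{⊗(n+1)}`. -/
def lAct : (n : ℕ) → QSA k N q →ₗ[k] (TP k N q n →ₗ[k] TP k N q n)
  | 0 => LinearMap.mul k (QSA k N q)
  | n + 1 => (LinearMap.rTensorHom (TP k N q n)).comp (LinearMap.mul k (QSA k N q))

/-- Right multiplication by an element of `A` on the last tensor factor of `A^{⊗(n+1)}`. -/
def rAct : (n : ℕ) → QSA k N q →ₗ[k] (TP k N q n →ₗ[k] TP k N q n)
  | 0 => (LinearMap.mul k (QSA k N q)).flip
  | n + 1 =>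
    show QSA k N q →ₗ[k]
        (QSA k N q ⊗[k] TP k N q n →ₗ[k] QSA k N q ⊗[k] TP k N q n) from
      (LinearMap.lTensorHom (QSA k N q)).comp (rAct n)

/-- The outer `A^e = A ⊗ A^{op}`-action on `A^{⊗(n+1)}`: `a ⊗ b^{op}` acts by multiplying
by `a` on the left in the first factor and by `b` on the right in the last factor. -/
def outerAct (n : ℕ) : QSAe k N q →ₗ[k] (TP k N q n →ₗ[k] TP k N q n) :=
  TensorProduct.lift
    (LinearMap.mk₂ k
      (fun a b => (lAct k N q n a).comp (rAct k N q n (MulOpposite.unop b)))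
      (fun a a' b => by simp [map_add, LinearMap.add_comp])
      (fun c a b => by simp [map_smul, LinearMap.smul_comp])
      (fun a b b' => by simp [map_add, LinearMap.comp_add])
      (fun c a b => by simp [map_smul, LinearMap.comp_smul]))

end QSA

section Bar
variable (k : Type) [Field k] (N : ℕ) (q : Fin N → Fin N → k)

/-- Multiplication of the first two tensor factors: `A^{⊗(n+2)} → A^{⊗(n+1)}`. -/
def barMul₀ : (n : ℕ) → (TP k N q (n + 1) →ₗ[k] TP k N q n)
  | 0 => LinearMap.mul' k (QSA k N q)
  | n + 1 =>
    show QSA k N q ⊗[k] (QSA k N q ⊗[k] TP k N q n) →ₗ[k] QSA k N q ⊗[k] TP k N q n from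
      (LinearMap.rTensor (TP k N q n) (LinearMap.mul' k (QSA k N q))).comp
        (TensorProduct.assoc k (QSA k N q) (QSA k N q) (TP k N q n)).symm.toLinearMap

/-- Multiplication of the tensor factors in positions `i, i+1` of `A^{⊗(n+2)}`
(0-indexed; for `i > n` we set the map to be zero, which does not occur below). -/
def barFace : (n : ℕ) → (i : ℕ) → (TP k N q (n + 1) →ₗ[k] TP k N q n)
  | n, 0 => barMul₀ k N q n
  | 0, _ + 1 => 0
  | n + 1, i + 1 =>
    show QSA k N q ⊗[k] TP k N q (n + 1) →ₗ[k] QSA k N q ⊗[k] TP k N q n from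
      LinearMap.lTensor (QSA k N q) (barFace n i)

/-- The bar differential `δ_n : A^{⊗(n+2)} → A^{⊗(n+1)}`,
`δ_n(a_0 ⊗ ⋯ ⊗ a_{n+1}) = Σ_{i=0}^{n} (-1)^i a_0 ⊗ ⋯ ⊗ a_i a_{i+1} ⊗ ⋯ ⊗ a_{n+1}`. -/
def barD (n : ℕ) : TP k N q (n + 1) →ₗ[k] TP k N q n :=
  ∑ i ∈ Finset.range (n + 1), ((-1 : ℤ) ^ i) • barFace k N q n i

end Bar

section Phi
variable (k : Type) [Field k] (N : ℕ) (q : Fin N → Fin N → k)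

/-- `A` is a left `A^e`-module via left and right multiplication. -/
instance : Module (QSAe k N q) (QSA k N q) := TensorProduct.Algebra.module

/-- The `m`-th term `A^e ⊗ ∧^m(V)` of the Koszul complex, realised as the free
`A^e`-module on the set of `m`-element subsets of `{1,…,N}` (corresponding to the basis
`x_{j_1} ∧ ⋯ ∧ x_{j_m}`, `j_1 < ⋯ < j_m`, of `∧^m(V)`). -/
abbrev KM (m : ℕ) := {S : Finset (Fin N) // S.card = m} →₀ QSAe k N q

/-- The increasing enumeration `j_1 < j_2 < ⋯ < j_m` of an `m`-element subset of `{1,…,N}`. -/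
def jfun (m : ℕ) (S : {S : Finset (Fin N) // S.card = m}) : Fin m → Fin N :=
  fun t => S.1.orderIsoOfFin S.2 t

/-- The element `Σ_{π ∈ S_m} sgn(π) q_π^{j_1,…,j_m} ⊗ x_{j_{π(1)}} ⊗ ⋯ ⊗ x_{j_{π(m)}} ⊗ 1`
of `A^{⊗(m+2)}`, where `Qs` encodes the scalars `q_π^{j_1,…,j_m}`. -/
def phiElt (Qs : (m : ℕ) → (Fin m → Fin N) → Equiv.Perm (Fin m) → k) (m : ℕ)
    (S : {S : Finset (Fin N) // S.card = m}) : TP k N q (m + 1) :=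
  ∑ π : Equiv.Perm (Fin m),
    ((Equiv.Perm.sign π : ℤ) • Qs m (jfun N m S) π) •
      tp k N q (m + 1)
        (Fin.cons 1 (Fin.snoc (fun t : Fin m => X k N q (jfun N m S (π t))) 1))

/-- The chain map `φ_m : A^e ⊗ ∧^m(V) → A^{⊗(m+2)}` of the paper, determined by
`φ_m(1 ⊗ 1 ⊗ x_{j_1} ∧ ⋯ ∧ x_{j_m}) =
  Σ_{π ∈ S_m} sgn(π) q_π^{j_1,…,j_m} ⊗ x_{j_{π(1)}} ⊗ ⋯ ⊗ x_{j_{π(m)}} ⊗ 1`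
together with `A^e`-linearity (the outer two tensor factors carry the `A^e`-action). -/
def phi (Qs : (m : ℕ) → (Fin m → Fin N) → Equiv.Perm (Fin m) → k) (m : ℕ) :
    KM k N q m →ₗ[k] TP k N q (m + 1) :=
  Finsupp.lsum k fun S => (outerAct k N q (m + 1)).flip (phiElt k N q Qs m S)

/-- The Koszul differential `d_{m+1}`, as an `A^e`-linear map. -/
def kd (m : ℕ) : KM k N q (m + 1) →ₗ[QSAe k N q] KM k N q m :=
  Finsupp.linearCombination (QSAe k N q)
    (fun S : {S : Finset (Fin N) // S.card = m + 1} =>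
      ∑ i ∈ S.1.attach,
        ((-1 : k) ^ (S.1.filter (fun s => s < i.1)).card) •
          Finsupp.single
            (⟨S.1.erase i.1, by rw [Finset.card_erase_of_mem i.2, S.2]; rfl⟩ :
              {S : Finset (Fin N) // S.card = m})
            ((∏ s ∈ S.1.filter (fun s => s ≤ i.1), q s i.1) •
                (X k N q i.1 ⊗ₜ[k] (1 : (QSA k N q)ᵐᵒᵖ))
              - (∏ s ∈ S.1.filter (fun s => i.1 ≤ s), q i.1 s) •
                ((1 : QSA k N q) ⊗ₜ[k] MulOpposite.op (X k N q i.1))))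

/-- The Koszul differential, as a `k`-linear map. -/
def kdk (m : ℕ) : KM k N q (m + 1) →ₗ[k] KM k N q m :=
  LinearMap.restrictScalars k (kd k N q m)

end Phi

section H
variable {k : Type} [Field k] {N : ℕ} {q : Fin N → Fin N → k}

/-- Prepending a tensor factor, as a bilinear map. -/
def ct (n : ℕ) : QSA k N q →ₗ[k] TP k N q n →ₗ[k] TP k N q (n + 1) :=
  TensorProduct.mk k (QSA k N q) (TP k N q n)

theorem ct_ext {n : ℕ} {M : Type} [AddCommGroup M] [Module k M]
    {f g : TP k N q (n + 1) →ₗ[k] M} (h : ∀ a t, f (ct n a t) = g (ct n a t)) : f = g :=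
  TensorProduct.ext' (R := k) (M := QSA k N q) (N := TP k N q n) h

theorem tp_succ (n : ℕ) (v : Fin (n + 2) → QSA k N q) :
    tp k N q (n + 1) v = ct n (v 0) (tp k N q n (fun t => v t.succ)) := rfl

theorem tp_zero (v : Fin 1 → QSA k N q) : tp k N q 0 v = v 0 := rfl

theorem lAct_ct (n : ℕ) (a b : QSA k N q) (t) :
    lAct k N q (n + 1) a (ct n b t) = ct n (a * b) t := rfl

theorem rAct_ct (n : ℕ) (a b : QSA k N q) (t) :
    rAct k N q (n + 1) a (ct n b t) = ct n b (rAct k N q n a t) := rfl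

theorem face_succ_ct (n i : ℕ) (b : QSA k N q) (t) :
    barFace k N q (n + 1) (i + 1) (ct (n + 1) b t) = ct n b (barFace k N q n i t) := rfl

theorem lAct_mul (n : ℕ) (a b : QSA k N q) (t) :
    lAct k N q n (a * b) t = lAct k N q n a (lAct k N q n b t) := by
  cases n with
  | zero => exact mul_assoc (G := QSA k N q) a b t
  | succ n =>
    revert t
    refine LinearMap.congr_fun (g := (lAct k N q (n+1) a).comp (lAct k N q (n+1) b))
      (ct_ext fun c t => ?_)
    simp [lAct_ct, mul_assoc]

theorem face_zero_ct (n : ℕ) (b : QSA k N q) (t) :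
    barFace k N q n 0 (ct n b t) = lAct k N q n b t := by
  cases n with
  | zero => rfl
  | succ n =>
    revert t
    refine LinearMap.congr_fun (f := (barFace k N q (n+1) 0).comp (ct (n+1) b))
      (ct_ext fun c t => ?_)
    rfl

theorem lAct_one (n : ℕ) (t) : lAct k N q n (1 : QSA k N q) t = t := by
  cases n with
  | zero => exact one_mul (M := QSA k N q) t
  | succ n =>
    revert t
    refine LinearMap.congr_fun (g := LinearMap.id)
      (ct_ext fun c t => ?_)
    simp [lAct_ct]

theorem rAct_one (n : ℕ) (t) : rAct k N q n (1 : QSA k N q) t = t := by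
  induction n with
  | zero => exact mul_one (M := QSA k N q) t
  | succ n ih =>
    revert t
    refine LinearMap.congr_fun (g := LinearMap.id)
      (ct_ext fun c t => ?_)
    simp [rAct_ct, ih]

theorem rAct_mul (n : ℕ) (a b : QSA k N q) (t) :
    rAct k N q n (a * b) t = rAct k N q n b (rAct k N q n a t) := by
  induction n with
  | zero => exact (mul_assoc (G := QSA k N q) t a b).symm
  | succ n ih =>
    revert t
    refine LinearMap.congr_fun (g := (rAct k N q (n+1) b).comp (rAct k N q (n+1) a))
      (ct_ext fun c t => ?_)
    simp [rAct_ct, ih]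

theorem lAct_rAct (n : ℕ) (a b : QSA k N q) (t) :
    lAct k N q n a (rAct k N q n b t) = rAct k N q n b (lAct k N q n a t) := by
  cases n with
  | zero => exact (mul_assoc (G := QSA k N q) a t b).symm
  | succ n =>
    revert t
    refine LinearMap.congr_fun (f := (lAct k N q (n+1) a).comp (rAct k N q (n+1) b))
      (g := (rAct k N q (n+1) b).comp (lAct k N q (n+1) a))
      (ct_ext fun c t => ?_)
    simp [rAct_ct, lAct_ct]

theorem face_lAct (n i : ℕ) (a : QSA k N q) (t) :
    barFace k N q n i (lAct k N q (n+1) a t) = lAct k N q n a (barFace k N q n i t) := by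
  revert t
  refine LinearMap.congr_fun (f := (barFace k N q n i).comp (lAct k N q (n+1) a))
      (g := (lAct k N q n a).comp (barFace k N q n i))
      (ct_ext fun c t => ?_)
  cases i with
  | zero => simp [face_zero_ct, lAct_ct, lAct_mul]
  | succ i =>
    cases n with
    | zero => simp [barFace]
    | succ n => simp [face_succ_ct, lAct_ct]

theorem face_rAct (n i : ℕ) (a : QSA k N q) (t) :
    barFace k N q n i (rAct k N q (n+1) a t) = rAct k N q n a (barFace k N q n i t) := by
  induction n generalizing i with
  | zero =>
    revert t
    refine LinearMap.congr_fun (f := (barFace k N q 0 i).comp (rAct k N q (0+1) a))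
      (g := (rAct k N q 0 a).comp (barFace k N q 0 i))
      (ct_ext fun c t => ?_)
    cases i with
    | zero => simp [face_zero_ct, rAct_ct, lAct_rAct]
    | succ i => simp [barFace]
  | succ n ih =>
    revert t
    refine LinearMap.congr_fun (f := (barFace k N q (n+1) i).comp (rAct k N q (n+1+1) a))
      (g := (rAct k N q (n+1) a).comp (barFace k N q (n+1) i))
      (ct_ext fun c t => ?_)
    cases i with
    | zero => simp [face_zero_ct, rAct_ct, lAct_rAct]
    | succ i => simp [face_succ_ct, rAct_ct, ih]

theorem outerAct_tmul (n : ℕ) (a : QSA k N q) (b : (QSA k N q)ᵐᵒᵖ) (t) :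
    outerAct k N q n (a ⊗ₜ b) t = lAct k N q n a (rAct k N q n b.unop t) := rfl

theorem outerAct_mul (n : ℕ) (x y : QSAe k N q) (t) :
    outerAct k N q n (x * y) t = outerAct k N q n x (outerAct k N q n y t) := by
  induction x using TensorProduct.induction_on with
  | zero => simp
  | add x x' h h' => simp [add_mul, h, h']
  | tmul a b =>
    induction y using TensorProduct.induction_on with
    | zero => simp
    | add x x' h h' => simp only [mul_add, map_add, LinearMap.add_apply, h, h']
    | tmul c d =>
      rw [Algebra.TensorProduct.tmul_mul_tmul]
      simp only [outerAct_tmul, MulOpposite.unop_mul, lAct_mul, rAct_mul, lAct_rAct]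

theorem barD_outerAct (n : ℕ) (x : QSAe k N q) (t) :
    barD k N q n (outerAct k N q (n+1) x t) = outerAct k N q n x (barD k N q n t) := by
  induction x using TensorProduct.induction_on with
  | zero => simp
  | add x x' h h' => simp [h, h']
  | tmul a b =>
    simp only [outerAct_tmul, barD, LinearMap.sum_apply, LinearMap.smul_apply, face_lAct,
      face_rAct, map_sum, map_zsmul]

/-! elementary tensors -/

theorem lAct_tp_cons (n : ℕ) (a b : QSA k N q) (v : Fin n → QSA k N q) :
    lAct k N q n a (tp k N q n (Fin.cons b v)) = tp k N q n (Fin.cons (a * b) v) := by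
  cases n <;> rfl

theorem rAct_tp_snoc (n : ℕ) (a b : QSA k N q) (v : Fin n → QSA k N q) :
    rAct k N q n a (tp k N q n (Fin.snoc v b)) = tp k N q n (Fin.snoc v (b * a)) := by
  induction n with
  | zero => rfl
  | succ n ih =>
    obtain ⟨c, w, rfl⟩ : ∃ c w, v = Fin.cons c w := ⟨v 0, Fin.tail v, (Fin.cons_self_tail v).symm⟩
    simp only [← Fin.cons_snoc_eq_snoc_cons]
    rw [tp_succ, tp_succ, rAct_ct]
    simp only [Fin.cons_succ, Fin.cons_zero]
    rw [← ih]

theorem face_zero_tp (n : ℕ) (v : Fin (n+1) → QSA k N q) :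
    barFace k N q n 0 (tp k N q (n+1) (Fin.cons 1 v)) = tp k N q n v := by
  rw [tp_succ, face_zero_ct]
  simp [lAct_one]

theorem face_last_tp (n : ℕ) (v : Fin (n+1) → QSA k N q) :
    barFace k N q n n (tp k N q (n+1) (Fin.snoc v 1)) = tp k N q n v := by
  induction n with
  | zero =>
    exact mul_one (M := QSA k N q) (v 0)
  | succ n ih =>
    obtain ⟨c, w, rfl⟩ : ∃ c w, v = Fin.cons c w := ⟨v 0, Fin.tail v, (Fin.cons_self_tail v).symm⟩
    simp only [← Fin.cons_snoc_eq_snoc_cons]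
    rw [tp_succ, face_succ_ct]
    simp only [Fin.cons_succ, Fin.cons_zero]
    rw [ih]
    rfl

theorem face_tp_swap (n : ℕ) (t : Fin (n + 1)) (c : k) (v w : Fin (n+2) → QSA k N q)
    (h : v t.castSucc * v t.succ = c • (w t.castSucc * w t.succ))
    (hvw : ∀ s, s ≠ t.castSucc → s ≠ t.succ → v s = w s) :
    barFace k N q n t (tp k N q (n+1) v) = c • barFace k N q n t (tp k N q (n+1) w) := by
  induction n with
  | zero =>
    obtain rfl : t = 0 := Fin.fin_one_eq_zero t
    exact h
  | succ n ih =>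
    rw [tp_succ (n+1) v, tp_succ (n+1) w]
    induction t using Fin.cases with
    | zero =>
      have h2 : (fun t : Fin (n+1) => v t.succ.succ) = fun t => w t.succ.succ := by
        funext t
        exact hvw _ (Fin.succ_ne_zero _) (fun h => Fin.succ_ne_zero _ (Fin.succ_injective _ h))
      rw [Fin.val_zero, face_zero_ct, face_zero_ct, tp_succ, tp_succ, lAct_ct, lAct_ct, h2]
      have h' : v 0 * v (Fin.succ 0) = c • (w 0 * w (Fin.succ 0)) := h
      rw [h', map_smul, LinearMap.smul_apply]
    | succ t =>
      rw [Fin.val_succ, face_succ_ct, face_succ_ct,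
        ih t (fun s => v s.succ) (fun s => w s.succ) h (fun s h1 h2 => hvw _
          (by simpa [← Fin.succ_castSucc] using h1) (by simpa using h2)),
        map_smul, hvw 0 (fun h => Fin.succ_ne_zero t.castSucc h.symm) (fun h => Fin.succ_ne_zero _ h.symm)]
end H

section HB
variable {k : Type} [Field k] {N : ℕ} {q : Fin N → Fin N → k}

theorem X_mul_X (i j : Fin N) : X k N q i * X k N q j = q i j • (X k N q j * X k N q i) := by
  simp only [X, ← map_mul, ← map_smul]
  exact RingQuot.mkAlgHom_rel k (QRel.rel i j)

/-- The scalar by which `x_i` acts on the monomial of exponent `a`. -/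
def repc (q : Fin N → Fin N → k) (i : Fin N) (a : Fin N → ℕ) : k :=
  ∏ s, if s < i then q i s ^ a s else 1

theorem repc_add (i j : Fin N) (a : Fin N → ℕ) :
    repc q i (a + Pi.single j 1) = (if j < i then q i j else 1) * repc q i a := by
  unfold repc
  have : ∀ s, (if s < i then q i s ^ ((a + Pi.single j 1 : Fin N → ℕ) s) else 1) =
      (if s = j then (if j < i then q i j else 1) else 1) * (if s < i then q i s ^ a s else 1) := by
    intro s
    by_cases h : s = j
    · subst h
      by_cases h2 : s < i <;> simp [h2, pow_succ, mul_comm]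
    · simp [h]
  rw [Finset.prod_congr rfl fun s _ => this s, Finset.prod_mul_distrib]
  simp

theorem repc_ne (hq0 : ∀ i j, q i j ≠ 0) (i : Fin N) (a : Fin N → ℕ) : repc q i a ≠ 0 := by
  refine Finset.prod_ne_zero_iff.mpr fun s _ => ?_
  split_ifs
  · exact pow_ne_zero _ (hq0 _ _)
  · exact one_ne_zero

/-- The operator by which `x_i` acts on the space with basis the monomials. -/
def repX (q : Fin N → Fin N → k) (i : Fin N) : Module.End k ((Fin N → ℕ) →₀ k) :=
  Finsupp.lsum k fun a => repc q i a • Finsupp.lsingle (a + Pi.single i 1)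

theorem repX_single (i : Fin N) (a : Fin N → ℕ) (c : k) :
    repX q i (Finsupp.single a c) = Finsupp.single (a + Pi.single i 1) (repc q i a * c) := by
  simp [repX]

theorem repX_rel (hq0 : ∀ i j, q i j ≠ 0) (hq1 : ∀ i, q i i = 1)
    (hqinv : ∀ i j, q j i = (q i j)⁻¹) (i j : Fin N) :
    repX q i * repX q j = q i j • (repX q j * repX q i) := by
  refine Finsupp.lhom_ext fun a c => ?_
  rw [Module.End.mul_apply, LinearMap.smul_apply, Module.End.mul_apply]
  simp only [repX_single, Finsupp.smul_single, smul_eq_mul, repc_add]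
  rw [add_right_comm]
  congr 1
  rcases lt_trichotomy i j with h | h | h
  · have := hq0 i j
    simp only [h, h.not_gt, if_true, if_false, hqinv i j]
    field_simp
  · subst h; simp [hq1]
  · simp only [h, h.not_gt, if_true, if_false]; ring

/-- The representation of `A` on the space with basis the monomials. -/
def rep (hq0 : ∀ i j, q i j ≠ 0) (hq1 : ∀ i, q i i = 1)
    (hqinv : ∀ i j, q j i = (q i j)⁻¹) : QSA k N q →ₐ[k] Module.End k ((Fin N → ℕ) →₀ k) :=
  RingQuot.liftAlgHom k ⟨FreeAlgebra.lift k (repX q), by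
    rintro _ _ ⟨i, j⟩
    simp only [map_mul, map_smul, FreeAlgebra.lift_ι_apply]
    exact repX_rel hq0 hq1 hqinv i j⟩

theorem rep_X (hq0 : ∀ i j, q i j ≠ 0) (hq1 : ∀ i, q i i = 1)
    (hqinv : ∀ i j, q j i = (q i j)⁻¹) (i : Fin N) :
    rep hq0 hq1 hqinv (X k N q i) = repX q i := by
  simp [rep, X]

theorem xprod_succ (m : ℕ) (j : Fin (m+1) → Fin N) :
    xprod k N q (m+1) j = X k N q (j 0) * xprod k N q m (fun t => j t.succ) := by
  simp [xprod, List.ofFn_succ]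

theorem xprod_succ' (m : ℕ) (j : Fin (m+1) → Fin N) :
    xprod k N q (m+1) j = xprod k N q m (fun t => j t.castSucc) * X k N q (j (Fin.last m)) := by
  rw [xprod, List.ofFn_succ', List.concat_eq_append, List.prod_append]
  simp [xprod]

theorem xprod_ne_zero (hq0 : ∀ i j, q i j ≠ 0) (hq1 : ∀ i, q i i = 1)
    (hqinv : ∀ i j, q j i = (q i j)⁻¹) (m : ℕ) (j : Fin m → Fin N) : xprod k N q m j ≠ 0 := by
  have key : ∀ (m : ℕ) (j : Fin m → Fin N), ∃ a c, c ≠ 0 ∧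
      rep hq0 hq1 hqinv (xprod k N q m j) (Finsupp.single 0 1) = Finsupp.single a c := by
    intro m
    induction m with
    | zero => exact fun j => ⟨0, 1, one_ne_zero, by simp [xprod]⟩
    | succ m ih =>
      intro j
      obtain ⟨a, c, hc, h⟩ := ih (fun t => j t.succ)
      refine ⟨a + Pi.single (j 0) 1, repc q (j 0) a * c, mul_ne_zero (repc_ne hq0 _ _) hc, ?_⟩
      rw [xprod_succ, map_mul, Module.End.mul_apply, h, rep_X, repX_single]
  obtain ⟨a, c, hc, h⟩ := key m j
  intro h0
  rw [h0, map_zero, LinearMap.zero_apply] at h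
  exact hc (Finsupp.single_eq_zero.mp h.symm)

theorem X_mul_xprod (i : Fin N) (m : ℕ) (j : Fin m → Fin N) :
    X k N q i * xprod k N q m j = (∏ s, q i (j s)) • (xprod k N q m j * X k N q i) := by
  induction m with
  | zero => simp [xprod]
  | succ m ih =>
    rw [xprod_succ, ← mul_assoc, X_mul_X, smul_mul_assoc, mul_assoc, ih, Fin.prod_univ_succ,
      mul_smul_comm, smul_smul, mul_assoc]

theorem xprod_left (m : ℕ) (j : Fin (m+1) → Fin N) (hq1 : ∀ i, q i i = 1) (i : Fin (m+1)) :
    xprod k N q (m+1) j = (∏ s, if s ≤ i then q (j s) (j i) else 1) •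
      (X k N q (j i) * xprod k N q m (fun t => j (i.succAbove t))) := by
  induction m with
  | zero =>
    obtain rfl : i = 0 := Fin.fin_one_eq_zero i
    simp [xprod_succ, hq1]
  | succ m ih =>
    induction i using Fin.cases with
    | zero => rw [xprod_succ, Fin.prod_univ_succ]; simp [hq1, Fin.succ_ne_zero]
    | succ i =>
      rw [xprod_succ, ih _ i, Fin.prod_univ_succ (n := m + 1), xprod_succ m]
      simp only [Fin.zero_le, if_true, Fin.succ_le_succ_iff, Fin.succ_succAbove_zero,
        Fin.succ_succAbove_succ]
      rw [mul_smul_comm, ← mul_assoc, X_mul_X (j 0), smul_mul_assoc, smul_smul, mul_assoc,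
        mul_comm (q _ _)]

theorem xprod_right (m : ℕ) (j : Fin (m+1) → Fin N) (hq1 : ∀ i, q i i = 1) (i : Fin (m+1)) :
    xprod k N q (m+1) j = (∏ s, if i ≤ s then q (j i) (j s) else 1) •
      (xprod k N q m (fun t => j (i.succAbove t)) * X k N q (j i)) := by
  induction m with
  | zero =>
    obtain rfl : i = 0 := Fin.fin_one_eq_zero i
    simp [xprod_succ, hq1]
    simp [xprod]
  | succ m ih =>
    induction i using Fin.cases with
    | zero => rw [xprod_succ, Fin.prod_univ_succ, X_mul_xprod]; simp [hq1]
    | succ i =>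
      rw [xprod_succ, ih _ i, Fin.prod_univ_succ (n := m + 1), xprod_succ m]
      simp only [Fin.succ_le_succ_iff, Fin.succ_succAbove_zero,
        Fin.succ_succAbove_succ]
      simp [Fin.succ_ne_zero, mul_assoc]

theorem xprod_swap (m : ℕ) (t : Fin m) (j j' : Fin (m+1) → Fin N)
    (h1 : j' t.castSucc = j t.succ) (h2 : j' t.succ = j t.castSucc)
    (h : ∀ s, s ≠ t.castSucc → s ≠ t.succ → j s = j' s) :
    xprod k N q (m+1) j = q (j t.castSucc) (j t.succ) • xprod k N q (m+1) j' := by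
  induction m with
  | zero => exact t.elim0
  | succ m ih =>
    induction t using Fin.cases with
    | zero =>
      have h2' : (fun t : Fin m => j t.succ.succ) = fun t => j' t.succ.succ := by
        funext t
        exact h _ (by simp [Fin.ext_iff]) (by simp [Fin.ext_iff])
      rw [xprod_succ, xprod_succ, xprod_succ _ j', xprod_succ _ (fun t => j' t.succ), h2',
        ← mul_assoc, ← mul_assoc, h2]
      have h1' : j' 0 = j (Fin.succ 0) := h1
      rw [h1', X_mul_X, smul_mul_assoc]
      rfl
    | succ t =>
      rw [xprod_succ, xprod_succ _ j', ih t (fun s => j s.succ) (fun s => j' s.succ) h1 h2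
        (fun s h1 h2 => h _ 
          (by simpa [← Fin.succ_castSucc] using h1) (by simpa using h2)),
        h 0 (by simp [Fin.ext_iff]) (by simp [Fin.ext_iff]), mul_smul_comm]
      rfl
end HB

section HC
variable {k : Type} [Field k] {N : ℕ} {q : Fin N → Fin N → k}

/-- The permutation sending `0` to `i` and `t + 1` to `i.succAbove (e t)`. -/
def permL {m : ℕ} (p : Fin (m+1) × Equiv.Perm (Fin m)) : Equiv.Perm (Fin (m+1)) :=
  p.1.cycleRange.symm * Equiv.Perm.decomposeFin.symm (0, p.2)

theorem permL_zero {m : ℕ} (p : Fin (m+1) × Equiv.Perm (Fin m)) : permL p 0 = p.1 := by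
  simp [permL]

theorem permL_succ {m : ℕ} (p : Fin (m+1) × Equiv.Perm (Fin m)) (t : Fin m) :
    permL p t.succ = p.1.succAbove (p.2 t) := by
  simp [permL]

theorem sign_permL {m : ℕ} (p : Fin (m+1) × Equiv.Perm (Fin m)) :
    Equiv.Perm.sign (permL p) = (-1) ^ (p.1 : ℕ) * Equiv.Perm.sign p.2 := by
  simp [permL, Fin.sign_cycleRange]

theorem permL_bij {m : ℕ} : Function.Bijective (permL (m := m)) := by
  rw [Fintype.bijective_iff_injective_and_card]
  constructor
  · rintro ⟨i, e⟩ ⟨i', e'⟩ h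
    have h0 : i = i' := by
      have h1 := permL_zero (i, e)
      rw [h, permL_zero] at h1
      exact h1.symm
    subst h0
    congr 1
    ext t : 1
    have := permL_succ (i, e) t
    rw [h, permL_succ] at this
    exact (Fin.succAbove_right_injective this).symm
  · simp [Fintype.card_perm, Nat.factorial_succ]

/-- The permutation sending the last element to `i` and `t` to `i.succAbove (e t)`. -/
def permR {m : ℕ} (p : Fin (m+1) × Equiv.Perm (Fin m)) : Equiv.Perm (Fin (m+1)) :=
  permL p * finRotate (m+1)

theorem permR_last {m : ℕ} (p : Fin (m+1) × Equiv.Perm (Fin m)) :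
    permR p (Fin.last m) = p.1 := by
  rw [permR, Equiv.Perm.mul_apply, finRotate_last, permL_zero]

theorem permR_castSucc {m : ℕ} (p : Fin (m+1) × Equiv.Perm (Fin m)) (t : Fin m) :
    permR p t.castSucc = p.1.succAbove (p.2 t) := by
  rw [permR, Equiv.Perm.mul_apply, ← permL_succ]
  congr 1
  exact finRotate_of_lt t.2

theorem sign_permR {m : ℕ} (p : Fin (m+1) × Equiv.Perm (Fin m)) :
    Equiv.Perm.sign (permR p) = (-1) ^ (p.1 : ℕ) * Equiv.Perm.sign p.2 * (-1) ^ m := by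
  rw [permR, map_mul, sign_permL, sign_finRotate, Nat.add_sub_cancel]

theorem permR_bij {m : ℕ} : Function.Bijective (permR (m := m)) :=
  (Equiv.mulRight (finRotate (m+1))).bijective.comp permL_bij

/-- `phiElt` for an arbitrary tuple `j`. -/
def PE (q : Fin N → Fin N → k) (Qs : (m : ℕ) → (Fin m → Fin N) → Equiv.Perm (Fin m) → k) (m : ℕ)
    (j : Fin m → Fin N) : TP k N q (m + 1) :=
  ∑ π : Equiv.Perm (Fin m),
    ((Equiv.Perm.sign π : ℤ) • Qs m j π) •
      tp k N q (m + 1)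
        (Fin.cons 1 (Fin.snoc (fun t : Fin m => X k N q (j (π t))) 1))

theorem Qs_unique (hq0 : ∀ i j, q i j ≠ 0) (hq1 : ∀ i, q i i = 1)
    (hqinv : ∀ i j, q j i = (q i j)⁻¹)
    {Qs : (m : ℕ) → (Fin m → Fin N) → Equiv.Perm (Fin m) → k}
    (hQs : ∀ (m : ℕ) (j : Fin m → Fin N), Function.Injective j →
      ∀ π : Equiv.Perm (Fin m),
        Qs m j π • xprod k N q m (fun t => j (π t)) = xprod k N q m j)
    {m : ℕ} {j : Fin m → Fin N} (hj : Function.Injective j)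
    (π : Equiv.Perm (Fin m)) (c : k)
    (h : xprod k N q m j = c • xprod k N q m (fun t => j (π t))) : Qs m j π = c := by
  rw [← hQs m j hj π] at h
  exact smul_left_injective k (xprod_ne_zero hq0 hq1 hqinv m _) h

theorem Qs_L (hq0 : ∀ i j, q i j ≠ 0) (hq1 : ∀ i, q i i = 1)
    (hqinv : ∀ i j, q j i = (q i j)⁻¹)
    {Qs : (m : ℕ) → (Fin m → Fin N) → Equiv.Perm (Fin m) → k}
    (hQs : ∀ (m : ℕ) (j : Fin m → Fin N), Function.Injective j →
      ∀ π : Equiv.Perm (Fin m),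
        Qs m j π • xprod k N q m (fun t => j (π t)) = xprod k N q m j)
    {m : ℕ} {j : Fin (m+1) → Fin N} (hj : Function.Injective j)
    (p : Fin (m+1) × Equiv.Perm (Fin m)) :
    Qs (m+1) j (permL p) = (∏ s, if s ≤ p.1 then q (j s) (j p.1) else 1) *
      Qs m (fun t => j (p.1.succAbove t)) p.2 := by
  apply Qs_unique hq0 hq1 hqinv hQs hj
  rw [xprod_left m j hq1 p.1, xprod_succ, ← hQs m (fun t => j (p.1.succAbove t))
    (hj.comp Fin.succAbove_right_injective) p.2, mul_smul_comm, smul_smul]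
  simp only [permL_zero, permL_succ]

theorem Qs_R (hq0 : ∀ i j, q i j ≠ 0) (hq1 : ∀ i, q i i = 1)
    (hqinv : ∀ i j, q j i = (q i j)⁻¹)
    {Qs : (m : ℕ) → (Fin m → Fin N) → Equiv.Perm (Fin m) → k}
    (hQs : ∀ (m : ℕ) (j : Fin m → Fin N), Function.Injective j →
      ∀ π : Equiv.Perm (Fin m),
        Qs m j π • xprod k N q m (fun t => j (π t)) = xprod k N q m j)
    {m : ℕ} {j : Fin (m+1) → Fin N} (hj : Function.Injective j)
    (p : Fin (m+1) × Equiv.Perm (Fin m)) :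
    Qs (m+1) j (permR p) = (∏ s, if p.1 ≤ s then q (j p.1) (j s) else 1) *
      Qs m (fun t => j (p.1.succAbove t)) p.2 := by
  apply Qs_unique hq0 hq1 hqinv hQs hj
  rw [xprod_right m j hq1 p.1, xprod_succ', ← hQs m (fun t => j (p.1.succAbove t))
    (hj.comp Fin.succAbove_right_injective) p.2, smul_mul_assoc, smul_smul]
  simp only [permR_last, permR_castSucc]

theorem Qs_swap (hq0 : ∀ i j, q i j ≠ 0) (hq1 : ∀ i, q i i = 1)
    (hqinv : ∀ i j, q j i = (q i j)⁻¹)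
    {Qs : (m : ℕ) → (Fin m → Fin N) → Equiv.Perm (Fin m) → k}
    (hQs : ∀ (m : ℕ) (j : Fin m → Fin N), Function.Injective j →
      ∀ π : Equiv.Perm (Fin m),
        Qs m j π • xprod k N q m (fun t => j (π t)) = xprod k N q m j)
    {m : ℕ} {j : Fin (m+1) → Fin N} (hj : Function.Injective j)
    (π : Equiv.Perm (Fin (m+1))) (t : Fin m) :
    Qs (m+1) j (π * Equiv.swap t.castSucc t.succ) =
      Qs (m+1) j π * q (j (π t.castSucc)) (j (π t.succ)) := by
  apply Qs_unique hq0 hq1 hqinv hQs hj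
  rw [← hQs (m+1) j hj π, xprod_swap m t (fun s => j (π s))
    (fun s => j ((π * Equiv.swap t.castSucc t.succ) s)) (by simp) (by simp), smul_smul]
  intro s h1 h2
  simp [Equiv.swap_apply_of_ne_of_ne h1 h2]

theorem mid_zero (hq0 : ∀ i j, q i j ≠ 0) (hq1 : ∀ i, q i i = 1)
    (hqinv : ∀ i j, q j i = (q i j)⁻¹)
    {Qs : (m : ℕ) → (Fin m → Fin N) → Equiv.Perm (Fin m) → k}
    (hQs : ∀ (m : ℕ) (j : Fin m → Fin N), Function.Injective j →
      ∀ π : Equiv.Perm (Fin m),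
        Qs m j π • xprod k N q m (fun t => j (π t)) = xprod k N q m j)
    {m : ℕ} {j : Fin (m+1) → Fin N} (hj : Function.Injective j) (t : Fin m) :
    barFace k N q (m+1) ((t : ℕ) + 1) (PE q Qs (m+1) j) = 0 := by
  rw [PE, map_sum]
  refine Finset.sum_involution (fun π _ => π * Equiv.swap t.castSucc t.succ) ?_ ?_
    (fun _ _ => Finset.mem_univ _) ?_
  · intro π _
    have key := face_tp_swap (q := q) (m+1) t.succ.castSucc (q (j (π t.castSucc)) (j (π t.succ)))
      (Fin.cons 1 (Fin.snoc (fun t : Fin (m+1) => X k N q (j (π t))) 1))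
      (Fin.cons 1 (Fin.snoc (fun s : Fin (m+1) =>
        X k N q (j ((π * Equiv.swap t.castSucc t.succ) s))) 1)) ?_ ?_
    · rw [map_smul, map_smul, Qs_swap hq0 hq1 hqinv hQs hj, map_mul,
        Equiv.Perm.sign_swap (Fin.castSucc_lt_succ).ne]
      have e : ((t.succ.castSucc : Fin (m+2)) : ℕ) = (t : ℕ) + 1 := rfl
      rw [e] at key
      rw [key]
      rw [smul_smul, ← add_smul]
      convert zero_smul k _
      simp [mul_assoc]
    · rw [← Fin.succ_castSucc]
      simp only [Fin.cons_succ]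
      rw [← Fin.castSucc_succ] 
      simp only [Fin.snoc_castSucc]
      simp [X_mul_X (j (π t.castSucc))]
    · intro s h1 h2
      induction s using Fin.cases with
      | zero => rfl
      | succ s =>
        simp only [Fin.cons_succ]
        induction s using Fin.lastCases with
        | last => simp
        | cast s =>
          simp only [Fin.snoc_castSucc]
          rw [Equiv.Perm.mul_apply, Equiv.swap_apply_of_ne_of_ne]
          · rintro rfl; exact h1 rfl
          · rintro rfl; exact h2 rfl
  · intro π _ _ h
    have := mul_eq_left.mp h
    exact (Fin.castSucc_lt_succ (i := t)).ne (Equiv.swap_eq_one_iff.mp this)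
  · intro π _
    simp [mul_assoc]

theorem first_face (hq0 : ∀ i j, q i j ≠ 0) (hq1 : ∀ i, q i i = 1)
    (hqinv : ∀ i j, q j i = (q i j)⁻¹)
    {Qs : (m : ℕ) → (Fin m → Fin N) → Equiv.Perm (Fin m) → k}
    (hQs : ∀ (m : ℕ) (j : Fin m → Fin N), Function.Injective j →
      ∀ π : Equiv.Perm (Fin m),
        Qs m j π • xprod k N q m (fun t => j (π t)) = xprod k N q m j)
    {m : ℕ} {j : Fin (m+1) → Fin N} (hj : Function.Injective j) :
    barFace k N q (m+1) 0 (PE q Qs (m+1) j) = ∑ i : Fin (m+1), ((-1 : k) ^ (i : ℕ)) •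
      (∏ s, if s ≤ i then q (j s) (j i) else 1) •
        lAct k N q (m+1) (X k N q (j i)) (PE q Qs m (fun t => j (i.succAbove t))) := by
  rw [PE, map_sum, ← permL_bij.sum_comp, Fintype.sum_prod_type]
  refine Finset.sum_congr rfl fun i _ => ?_
  rw [PE, map_sum, Finset.smul_sum, Finset.smul_sum]
  refine Finset.sum_congr rfl fun e _ => ?_
  rw [map_smul, face_zero_tp, map_smul, lAct_tp_cons, Qs_L hq0 hq1 hqinv hQs hj, sign_permL,
    smul_smul, smul_smul, mul_one]
  congr 1
  · simp only [Units.val_mul, Units.val_pow_eq_pow_val, Units.val_neg, Units.val_one,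
      zsmul_eq_mul, Int.cast_mul, Int.cast_pow, Int.cast_neg, Int.cast_one]
    ring
  · congr 1
    rw [Fin.cons_snoc_eq_snoc_cons]
    congr 1
    funext s
    induction s using Fin.cases with
    | zero => simp [permL_zero]
    | succ s => simp [permL_succ]

theorem last_face (hq0 : ∀ i j, q i j ≠ 0) (hq1 : ∀ i, q i i = 1)
    (hqinv : ∀ i j, q j i = (q i j)⁻¹)
    {Qs : (m : ℕ) → (Fin m → Fin N) → Equiv.Perm (Fin m) → k}
    (hQs : ∀ (m : ℕ) (j : Fin m → Fin N), Function.Injective j →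
      ∀ π : Equiv.Perm (Fin m),
        Qs m j π • xprod k N q m (fun t => j (π t)) = xprod k N q m j)
    {m : ℕ} {j : Fin (m+1) → Fin N} (hj : Function.Injective j) :
    ((-1 : ℤ) ^ (m+1)) • barFace k N q (m+1) (m+1) (PE q Qs (m+1) j) =
     - ∑ i : Fin (m+1), ((-1 : k) ^ (i : ℕ)) •
      (∏ s, if i ≤ s then q (j i) (j s) else 1) •
        rAct k N q (m+1) (X k N q (j i)) (PE q Qs m (fun t => j (i.succAbove t))) := by
  rw [PE, map_sum, ← permR_bij.sum_comp, Fintype.sum_prod_type, Finset.smul_sum,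
    ← Finset.sum_neg_distrib]
  refine Finset.sum_congr rfl fun i _ => ?_
  rw [PE, map_sum, Finset.smul_sum, Finset.smul_sum, Finset.smul_sum, ← Finset.sum_neg_distrib]
  refine Finset.sum_congr rfl fun e _ => ?_
  rw [map_smul, Fin.cons_snoc_eq_snoc_cons, face_last_tp, map_smul, Fin.cons_snoc_eq_snoc_cons,
    rAct_tp_snoc, Qs_R hq0 hq1 hqinv hQs hj, sign_permR,
    smul_smul, smul_smul, one_mul, ← Int.cast_smul_eq_zsmul k, smul_smul, ← neg_smul]
  congr 1
  · simp only [Units.val_mul, Units.val_pow_eq_pow_val, Units.val_neg, Units.val_one,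
      zsmul_eq_mul, Int.cast_mul, Int.cast_pow, Int.cast_neg, Int.cast_one]
    have : (-1 : k) ^ m * (-1) ^ m = 1 := by rw [← mul_pow]; simp
    linear_combination (-(-1 : k) ^ (i : ℕ) * ((Equiv.Perm.sign e : ℤ) : k) *
      (∏ s, if i ≤ s then q (j i) (j s) else 1) *
        Qs m (fun t => j (i.succAbove t)) e) * this
  · congr 1
    rw [← Fin.cons_snoc_eq_snoc_cons]
    congr 1
    funext s
    induction s using Fin.lastCases with
    | last => simp [permR_last]
    | cast s => simp [permR_castSucc]

theorem core (hq0 : ∀ i j, q i j ≠ 0) (hq1 : ∀ i, q i i = 1)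
    (hqinv : ∀ i j, q j i = (q i j)⁻¹)
    {Qs : (m : ℕ) → (Fin m → Fin N) → Equiv.Perm (Fin m) → k}
    (hQs : ∀ (m : ℕ) (j : Fin m → Fin N), Function.Injective j →
      ∀ π : Equiv.Perm (Fin m),
        Qs m j π • xprod k N q m (fun t => j (π t)) = xprod k N q m j)
    {m : ℕ} {j : Fin (m+1) → Fin N} (hj : Function.Injective j) :
    barD k N q (m+1) (PE q Qs (m+1) j) = ∑ i : Fin (m+1), ((-1 : k) ^ (i : ℕ)) •
      outerAct k N q (m+1) ((∏ s, if s ≤ i then q (j s) (j i) else 1) •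
                (X k N q (j i) ⊗ₜ[k] (1 : (QSA k N q)ᵐᵒᵖ))
              - (∏ s, if i ≤ s then q (j i) (j s) else 1) •
                ((1 : QSA k N q) ⊗ₜ[k] MulOpposite.op (X k N q (j i))))
        (PE q Qs m (fun t => j (i.succAbove t))) := by
  rw [barD, LinearMap.sum_apply, Finset.sum_range_succ, Finset.sum_range_succ']
  simp only [LinearMap.smul_apply]
  rw [last_face hq0 hq1 hqinv hQs hj, first_face hq0 hq1 hqinv hQs hj, Finset.sum_eq_zero, zero_add,
    pow_zero, one_smul, ← sub_eq_add_neg, ← Finset.sum_sub_distrib]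
  · refine Finset.sum_congr rfl fun i _ => ?_
    rw [map_sub, map_smul, map_smul, LinearMap.sub_apply, LinearMap.smul_apply,
      LinearMap.smul_apply, outerAct_tmul, outerAct_tmul, smul_sub]
    simp only [MulOpposite.unop_one, MulOpposite.unop_op, lAct_one, rAct_one]
  · intro t ht
    rw [mid_zero hq0 hq1 hqinv hQs hj ⟨t, Finset.mem_range.mp ht⟩, smul_zero]

end HC

section HD
variable {k : Type} [Field k] {N : ℕ} {q : Fin N → Fin N → k}

theorem jfun_strictMono (m : ℕ) (S : {S : Finset (Fin N) // S.card = m}) :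
    StrictMono (jfun N m S) := fun _ _ h => (S.1.orderIsoOfFin S.2).strictMono h

theorem jfun_mem (m : ℕ) (S : {S : Finset (Fin N) // S.card = m}) (t : Fin m) :
    jfun N m S t ∈ S.1 := (S.1.orderIsoOfFin S.2 t).2

theorem jfun_erase (m : ℕ) (S : {S : Finset (Fin N) // S.card = m + 1}) (i : Fin (m+1)) (h) :
    jfun N m ⟨S.1.erase (jfun N (m+1) S i), h⟩ = fun t => jfun N (m+1) S (i.succAbove t) := by
  symm
  refine Finset.orderEmbOfFin_unique h (fun t => ?_) ?_
  · refine Finset.mem_erase.mpr ⟨fun e => ?_, jfun_mem _ _ _⟩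
    exact Fin.succAbove_ne i t ((jfun_strictMono _ S).injective e)
  · exact (jfun_strictMono _ S).comp (Fin.strictMono_succAbove i)

theorem S_eq_map (m : ℕ) (S : {S : Finset (Fin N) // S.card = m}) :
    S.1 = Finset.univ.map ⟨jfun N m S, (jfun_strictMono m S).injective⟩ := by
  symm
  apply Finset.eq_of_subset_of_card_le
  · intro x hx
    obtain ⟨t, -, rfl⟩ := Finset.mem_map.mp hx
    exact jfun_mem m S t
  · simp [S.2]

theorem prod_filter_S (m : ℕ) (S : {S : Finset (Fin N) // S.card = m}) (p : Fin N → Prop)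
    [DecidablePred p] (f : Fin N → k) :
    ∏ s ∈ S.1.filter p, f s = ∏ t, if p (jfun N m S t) then f (jfun N m S t) else 1 := by
  rw [Finset.prod_filter]
  conv_lhs => rw [S_eq_map m S]
  rw [Finset.prod_map]
  rfl

theorem card_filter_S (m : ℕ) (S : {S : Finset (Fin N) // S.card = m}) (i : Fin m) :
    (S.1.filter (fun s => s < jfun N m S i)).card = i := by
  have h : S.1.filter (fun s => s < jfun N m S i) =
      (Finset.univ.filter (fun t => t < i)).map
        ⟨jfun N m S, (jfun_strictMono m S).injective⟩ := by
    conv_lhs => rw [S_eq_map m S]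
    rw [Finset.filter_map]
    congr 1
    ext t
    simp [(jfun_strictMono m S).lt_iff_lt]
  have h2 : (Finset.univ.filter (fun t => t < i)) = Finset.Iio i := by
    ext t
    rw [Finset.mem_filter, Finset.mem_Iio]
    exact and_iff_right (Finset.mem_univ t)
  rw [h, Finset.card_map, h2, Fin.card_Iio]

end HD

theorem phi_single (k : Type) [Field k] (N : ℕ) (q : Fin N → Fin N → k)
    (Qs : (m : ℕ) → (Fin m → Fin N) → Equiv.Perm (Fin m) → k) (m : ℕ) (S) (a : QSAe k N q) :
    phi k N q Qs m (Finsupp.single S a) = outerAct k N q (m+1) a (phiElt k N q Qs m S) := by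
  simp [phi]

/-- Lemma 2.3 of the paper: `φ` is a chain map from the Koszul complex to the bar
resolution, i.e. `φ_m ∘ d_{m+1} = δ_{m+1} ∘ φ_{m+1}` for all `m ≥ 0` (in the paper's
indexing, `φ_{m-1} ∘ d_m = δ_m ∘ φ_m` for all `m ≥ 1`; `φ_0` is the canonical
identification of `A^e ⊗ ∧^0(V) = A^e` with `A ⊗ A`, which is built into `phi 0`). -/
theorem stmt5 (k : Type) [Field k] [CharZero k] (N : ℕ) (hN : 0 < N)
    (q : Fin N → Fin N → k) (hq0 : ∀ i j, q i j ≠ 0) (hq1 : ∀ i, q i i = 1)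
    (hqinv : ∀ i j, q j i = (q i j)⁻¹)
    (Qs : (m : ℕ) → (Fin m → Fin N) → Equiv.Perm (Fin m) → k)
    -- `Qs m j π` is the scalar `q_π^{j_1,…,j_m}`, characterised by the equation
    -- `q_π^{j_1,…,j_m} • x_{j_{π(1)}} ⋯ x_{j_{π(m)}} = x_{j_1} ⋯ x_{j_m}` in `S_q(V)`:
    (hQs : ∀ (m : ℕ) (j : Fin m → Fin N), Function.Injective j →
      ∀ π : Equiv.Perm (Fin m),
        Qs m j π • xprod k N q m (fun t => j (π t)) = xprod k N q m j)
    (m : ℕ) :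
    (phi k N q Qs m).comp (kdk k N q m) = (barD k N q (m + 1)).comp (phi k N q Qs (m + 1)) := by
  refine Finsupp.lhom_ext fun S a => ?_
  rw [LinearMap.comp_apply, LinearMap.comp_apply, phi_single, barD_outerAct]
  have e1 : phiElt k N q Qs (m+1) S = PE q Qs (m+1) (jfun N (m+1) S) := rfl
  rw [e1, core hq0 hq1 hqinv hQs (jfun_strictMono _ S).injective, kdk,
    LinearMap.restrictScalars_apply, kd, Finsupp.linearCombination_single, Finset.smul_sum,
    map_sum, map_sum, ← Finset.univ_eq_attach,
    ← (S.1.orderIsoOfFin S.2).toEquiv.sum_comp]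
  refine Finset.sum_congr rfl fun i _ => ?_
  have e2 : (((S.1.orderIsoOfFin S.2).toEquiv i : S.1) : Fin N) = jfun N (m+1) S i := rfl
  rw [smul_comm, map_smul, Finsupp.smul_single, phi_single, smul_eq_mul, outerAct_mul,
    map_smul (outerAct k N q (m+1) a)]
  simp only [e2]
  rw [card_filter_S, prod_filter_S, prod_filter_S]
  simp only [(jfun_strictMono _ S).le_iff_le]
  have e3 : ∀ h, phiElt k N q Qs m ⟨S.1.erase (jfun N (m+1) S i), h⟩ =
      PE q Qs m (fun t => jfun N (m+1) S (i.succAbove t)) := by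
    intro h
    rw [← jfun_erase m S i h]
    rfl
  rw [e3]
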